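/- Let n ≥ 1 and let γ be a real symmetric 4n×4n matrix which is the covariance matrix of a pure Gaussian state of n×n modes, written in 2n×2n blocks γ = [[A, C],[Cᵀ, B]] with respect to the A|B split; that is, γ + i·σ_{2n} is positive semidefinite as a complex Hermitian matrix and (γ·σ_{2n})² = −I_{4n}, where σ_{2n} = σ_n ⊕ σ_n. Then there exist real symplectic 2n×2n matrices S_A and S_B (S_A σ_n S_Aᵀ = σ_n, S_B σ_n S_Bᵀ = σ_n) and a vector r ∈ ℝⁿ with r₁ ≥ r₂ ≥ … ≥ r_n ≥ 0 such that (S_A ⊕ S_B) γ (S_A ⊕ S_B)ᵀ = [[c(r), s(r)],[s(r), c(r)]]. In other words, every pure Gaussian state of n×n modes can be brought by local Gaussian unitary operations into a tensor product of n two-mode squeezed states with squeezing parameters r₁ ≥ … ≥ r_n ≥ 0. -/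

import Mathlib

open Matrix
open scoped ComplexOrder

/-- The standard symplectic form `σ_m = ⊕_{i=1}^m [[0,-1],[1,0]]` on `ℝ^{2m}`. -/
noncomputable def symp (m : ℕ) : Matrix (Fin (2 * m)) (Fin (2 * m)) ℝ :=
  Matrix.of fun i j =>
    if i.val = j.val + 1 ∧ i.val % 2 = 1 then 1
    else if j.val = i.val + 1 ∧ j.val % 2 = 1 then -1 else 0

/-- `σ_{2m} = σ_m ⊕ σ_m`, the symplectic form on the bipartite `(m + m)`-mode system. -/
noncomputable def sympBig (m : ℕ) :
    Matrix (Fin (2 * m) ⊕ Fin (2 * m)) (Fin (2 * m) ⊕ Fin (2 * m)) ℝ :=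
  Matrix.fromBlocks (symp m) 0 0 (symp m)

/-- `c(r) = ⊕_k cosh(r_k)·I₂`. -/
noncomputable def cmat {n : ℕ} (r : Fin n → ℝ) : Matrix (Fin (2 * n)) (Fin (2 * n)) ℝ :=
  Matrix.diagonal fun i => Real.cosh (r ⟨i.val / 2, by have := i.isLt; omega⟩)

/-- `s(r) = ⊕_k sinh(r_k)·Λ`, `Λ = diag(1,-1)`. -/
noncomputable def smat {n : ℕ} (r : Fin n → ℝ) : Matrix (Fin (2 * n)) (Fin (2 * n)) ℝ :=
  Matrix.diagonal fun i =>
    (if i.val % 2 = 0 then (1 : ℝ) else -1) * Real.sinh (r ⟨i.val / 2, by have := i.isLt; omega⟩)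


theorem sqrt_exists {m : Type*} [Fintype m] [DecidableEq m] {A : Matrix m m ℝ} (hA : A.PosDef) :
    ∃ R : Matrix m m ℝ, R.PosDef ∧ R * R = A := by
  have hs := hA.1.spectral_theorem
  rw [Unitary.conjStarAlgAut_apply] at hs
  set U := hA.1.eigenvectorUnitary with hU
  have hUU : star (U : Matrix m m ℝ) * (U : Matrix m m ℝ) = 1 := Unitary.coe_star_mul_self U
  have hUU' : (U : Matrix m m ℝ) * star (U : Matrix m m ℝ) = 1 := Unitary.coe_mul_star_self U
  have hu : IsUnit (U : Matrix m m ℝ) := ⟨⟨_, _, hUU', hUU⟩, rfl⟩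
  refine ⟨(U : Matrix m m ℝ) * diagonal (fun i => √(hA.1.eigenvalues i)) * star (U : Matrix m m ℝ), ?_, ?_⟩
  · rw [Matrix.IsUnit.posDef_star_right_conjugate_iff hu]
    exact Matrix.PosDef.diagonal fun i => Real.sqrt_pos.2 (hA.eigenvalues_pos i)
  · conv_rhs => rw [hs]
    have : diagonal (fun i => √(hA.1.eigenvalues i)) * diagonal (fun i => √(hA.1.eigenvalues i)) =
        diagonal (RCLike.ofReal ∘ hA.1.eigenvalues : m → ℝ) := by
      rw [diagonal_mul_diagonal]
      congr 1; ext i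
      simp [Real.mul_self_sqrt (hA.eigenvalues_pos i).le]
    rw [← this]
    simp only [Matrix.mul_assoc]
    rw [← Matrix.mul_assoc (star (U : Matrix m m ℝ)) (U : Matrix m m ℝ), hUU, Matrix.one_mul]

theorem sylvester {m k : Type*} [Fintype m] [DecidableEq m] [Fintype k] [DecidableEq k]
    {A : Matrix m m ℝ} {B : Matrix k k ℝ} {D : Matrix m k ℝ}
    (hA : A.PosDef) (hB : B.PosDef) (h : A * D + D * B = 0) : D = 0 := by
  obtain ⟨R, hR, rfl⟩ := sqrt_exists hA
  have h1 : (Dᵀ * (R * R) * D).trace + (D * B * Dᵀ).trace = 0 := by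
    have := congrArg (fun X => (Dᵀ * X).trace) h
    simp only [Matrix.mul_add, Matrix.mul_zero, Matrix.trace_add, Matrix.trace_zero] at this
    rw [← this, Matrix.trace_mul_comm (D * B) Dᵀ]
    simp only [Matrix.mul_assoc]
  have h2 : 0 ≤ (D * B * Dᵀ).trace := by
    have := (hB.posSemidef.mul_mul_conjTranspose_same D).trace_nonneg
    simpa using this
  have hRs : Rᵀ = R := by simpa [Matrix.IsHermitian] using hR.1
  have h3 : ((R * D)ᴴ * (R * D)).trace = (Dᵀ * (R * R) * D).trace := by
    simp [Matrix.transpose_mul, hRs, Matrix.mul_assoc]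
  have h4 : 0 ≤ ((R * D)ᴴ * (R * D)).trace := (posSemidef_conjTranspose_mul_self (R * D)).trace_nonneg
  have h5 : ((R * D)ᴴ * (R * D)).trace = 0 := by linarith
  rw [trace_conjTranspose_mul_self_eq_zero_iff] at h5
  have hdet : IsUnit R.det := (Matrix.isUnit_iff_isUnit_det _).1 hR.isUnit
  have := congrArg (R⁻¹ * ·) h5
  simpa [Matrix.nonsing_inv_mul_cancel_left _ _ hdet] using this

theorem sqrt_uniq {m : Type*} [Fintype m] [DecidableEq m] {X Y : Matrix m m ℝ}
    (hX : X.PosDef) (hY : Y.PosDef) (h : X * X = Y * Y) : X = Y := by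
  have : X - Y = 0 := sylvester hX hY (by
    rw [Matrix.mul_sub, Matrix.sub_mul, h]; abel)
  exact sub_eq_zero.1 this

theorem sqrt_comm {m : Type*} [Fintype m] [DecidableEq m] {R N : Matrix m m ℝ}
    (hR : R.PosDef) (h : N * (R * R) = R * R * N) : R * N = N * R := by
  have : R * N - N * R = 0 := sylvester hR hR (by
    rw [Matrix.mul_sub, Matrix.sub_mul, Matrix.mul_assoc N R R, h]; 
    simp only [Matrix.mul_assoc]; abel)
  exact sub_eq_zero.1 this

/-- Partial Williamson: `A > 0` can be symplectically conjugated to commute with `σ`. -/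
theorem partial_williamson {m : Type*} [Fintype m] [DecidableEq m] {A J : Matrix m m ℝ}
    (hA : A.PosDef) (hJt : Jᵀ = -J) (hJ : J * J = -1) :
    ∃ S : Matrix m m ℝ, S.PosDef ∧ S * J * S = J ∧ (S * A * S) * J = J * (S * A * S) := by
  obtain ⟨R, hR, hRA⟩ := sqrt_exists hA
  have hRs : Rᵀ = R := by simpa [Matrix.IsHermitian] using hR.1
  have hRu : IsUnit R := hR.isUnit
  have hJu : IsUnit J := ⟨⟨J, -J, by simp [hJ], by simp [hJ]⟩, rfl⟩
  obtain ⟨N, hN⟩ : ∃ N, N = R * J * R := ⟨_, rfl⟩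
  have hNu : IsUnit N := hN ▸ (hRu.mul hJu).mul hRu
  have hNt : Nᵀ = -N := by rw [hN]; simp [Matrix.transpose_mul, hRs, hJt, Matrix.mul_assoc]
  have hNN : (-(N * N)).PosDef := by
    have : -(N * N) = star N * N := by
      rw [Matrix.star_eq_conjTranspose, conjTranspose_eq_transpose_of_trivial, hNt]; simp
    have h1 := (Matrix.IsUnit.posDef_star_left_conjugate_iff hNu (x := (1 : Matrix m m ℝ))).2 Matrix.PosDef.one
    rw [this]; simpa using h1
  obtain ⟨P, hP, hPN⟩ := sqrt_exists hNN
  have hPc : P * N = N * P := sqrt_comm hP (by rw [hPN]; simp [Matrix.mul_assoc])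
  have hPd : IsUnit P.det := (Matrix.isUnit_iff_isUnit_det _).1 hP.isUnit
  obtain ⟨Q, hQ⟩ : ∃ Q, Q = P⁻¹ := ⟨_, rfl⟩
  have hQp : Q.PosDef := hQ ▸ hP.inv
  have hQP : Q * P = 1 := hQ ▸ Matrix.nonsing_inv_mul P hPd
  have hPQ : P * Q = 1 := hQ ▸ Matrix.mul_nonsing_inv P hPd
  have hQN : Q * N = N * Q := by
    calc Q * N = Q * (N * P) * Q := by rw [Matrix.mul_assoc, Matrix.mul_assoc, hPQ, Matrix.mul_one]
      _ = N * Q := by rw [← hPc, ← Matrix.mul_assoc, hQP, Matrix.one_mul]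
  -- N * Q * (Q * N) = -1
  have hQNQ : Q * N * Q * N = -1 := by
    have : N * N = -(P * P) := by rw [hPN]; simp
    calc Q * N * Q * N = Q * (N * Q) * N := by simp only [Matrix.mul_assoc]
      _ = Q * Q * (N * N) := by rw [← hQN]; simp only [Matrix.mul_assoc]
      _ = -(Q * (Q * P) * P) := by rw [this]; simp [Matrix.mul_assoc]
      _ = -1 := by rw [hQP]; simp [hQP]
  obtain ⟨G, hG⟩ : ∃ G, G = R * Q * R := ⟨_, rfl⟩
  have hGp : G.PosDef := by
    have := (Matrix.IsUnit.posDef_star_right_conjugate_iff hRu (x := Q)).2 hQp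
    rw [Matrix.star_eq_conjTranspose, conjTranspose_eq_transpose_of_trivial, hRs] at this
    rwa [hG]
  have hGJG : G * J * G = J := by
    have e1 : G * J * G * J * R = R * (Q * N * Q * N) := by
      rw [hG, hN]; simp only [Matrix.mul_assoc]
    rw [hQNQ] at e1
    have e2 : G * J * G * J = -1 := by
      apply hRu.mul_right_cancel
      rw [e1]; simp
    apply hJu.mul_right_cancel
    rw [e2, hJ]
  have hAG : A * J * G = G * J * A := by
    have e1 : A * J * G = R * (N * Q) * R := by
      rw [← hRA, hG, hN]; simp only [Matrix.mul_assoc]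
    have e2 : G * J * A = R * (Q * N) * R := by
      rw [← hRA, hG, hN]; simp only [Matrix.mul_assoc]
    rw [e1, e2, hQN]
  obtain ⟨T, hT, hTG⟩ := sqrt_exists hGp
  have hTd : IsUnit T.det := (Matrix.isUnit_iff_isUnit_det _).1 hT.isUnit
  obtain ⟨S, hS⟩ : ∃ S, S = T⁻¹ := ⟨_, rfl⟩
  have hSp : S.PosDef := hS ▸ hT.inv
  have hST : S * T = 1 := hS ▸ Matrix.nonsing_inv_mul T hTd
  have hTS : T * S = 1 := hS ▸ Matrix.mul_nonsing_inv T hTd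
  have hSG : S * S * G = 1 := by
    rw [← hTG, Matrix.mul_assoc, ← Matrix.mul_assoc S T T, hST, Matrix.one_mul, hST]
  have hJS : -J * T * J = S := by
    apply sqrt_uniq _ hSp
    · have e1 : -J * T * J * (-J * T * J) = -(J * G * J) := by
        calc -J * T * J * (-J * T * J) = J * T * (J * J) * T * J := by simp [Matrix.mul_assoc]
          _ = _ := by rw [hJ, ← hTG]; simp [Matrix.mul_assoc]
      rw [e1]
      apply hGp.isUnit.mul_right_cancel
      rw [hSG]
      calc -(J * G * J) * G = -(J * (G * J * G)) := by simp [Matrix.mul_assoc]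
        _ = 1 := by rw [hGJG, hJ]; simp
    · have := (Matrix.IsUnit.posDef_star_left_conjugate_iff hJu (x := T)).2 hT
      rwa [Matrix.star_eq_conjTranspose, conjTranspose_eq_transpose_of_trivial, hJt] at this
  have hTJ : T * J = J * S := by
    rw [← hJS]
    have : J * (-J * T * J) = -(J * J) * T * J := by simp [Matrix.mul_assoc]
    rw [this, hJ]; simp
  have hSJS : S * J * S = J := by
    rw [Matrix.mul_assoc, ← hTJ, ← Matrix.mul_assoc, hST, Matrix.one_mul]
  refine ⟨S, hSp, hSJS, ?_⟩
  have hJT : S * J = J * T := by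
    calc S * J = S * J * (S * T) := by rw [hST, Matrix.mul_one]
      _ = J * T := by rw [← Matrix.mul_assoc, hSJS]
  apply hT.isUnit.mul_right_cancel
  apply hT.isUnit.mul_left_cancel
  have e1 : T * (S * A * S * J * T) = A * J * G := by
    calc T * (S * A * S * J * T) = (T * S) * A * (S * J) * T := by simp only [Matrix.mul_assoc]
      _ = _ := by rw [hTS, hJT, Matrix.one_mul, ← hTG]; simp only [Matrix.mul_assoc]
  have e2 : T * (J * (S * A * S) * T) = G * J * A := by
    calc T * (J * (S * A * S) * T) = T * (J * S) * A * (S * T) := by simp only [Matrix.mul_assoc]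
      _ = _ := by rw [hST, ← hTJ, Matrix.mul_one, ← hTG]; simp only [Matrix.mul_assoc]
  rw [e1, e2, hAG]

theorem diag_row_zero {n : ℕ} {W : Matrix (Fin n) (Fin n) ℂ} {l : Fin n → ℝ}
    (h : W * Wᴴ = diagonal (fun i => (l i : ℂ))) (i : Fin n) (hi : l i = 0) (j : Fin n) :
    W i j = 0 := by
  have h1 := congrFun (congrFun h i) i
  simp only [Matrix.mul_apply, conjTranspose_apply, diagonal_apply_eq, hi, Complex.ofReal_zero,
    RCLike.star_def, Complex.mul_conj] at h1
  rw [← Complex.ofReal_sum, Complex.ofReal_eq_zero,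
    Finset.sum_eq_zero_iff_of_nonneg (fun _ _ => Complex.normSq_nonneg _)] at h1
  exact Complex.normSq_eq_zero.1 (h1 j (Finset.mem_univ _))

theorem svd_aux {n : ℕ} {W : Matrix (Fin n) (Fin n) ℂ} {l : Fin n → ℝ} (hl : ∀ i, 0 ≤ l i)
    (h : W * Wᴴ = diagonal (fun i => (l i : ℂ))) (h' : Wᴴ * W = diagonal (fun i => (l i : ℂ))) :
    ∃ Q : Matrix (Fin n) (Fin n) ℂ, Q * Qᴴ = 1 ∧
      W = diagonal (fun i => ((√(l i) : ℝ) : ℂ)) * Q := by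
  have hcol : ∀ j, l j = 0 → ∀ i, W i j = 0 := by
    intro j hj i
    have := diag_row_zero (W := Wᴴ) (l := l) (by simpa using h') j hj i
    simpa using this
  have hrow := diag_row_zero h
  let f : Fin n → ℂ := fun i => (((√(l i))⁻¹ : ℝ) : ℂ)
  let p : Fin n → ℂ := fun i => if l i = 0 then 1 else 0
  refine ⟨diagonal f * W + diagonal p, ?_, ?_⟩
  · have hWp : W * diagonal p = 0 := by
      ext i j
      simp only [mul_diagonal, p, Matrix.zero_apply]
      split_ifs with hj
      · simp [hcol j hj]
      · simp
    have hfs : (diagonal f)ᴴ = diagonal f := by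
      rw [diagonal_conjTranspose]; congr 1; ext i; simp [f]
    have hps : (diagonal p)ᴴ = diagonal p := by
      rw [diagonal_conjTranspose]; congr 1; ext i; simp only [p, Pi.star_apply]; split_ifs <;> simp
    have hpW : diagonal p * Wᴴ = 0 := by
      have := congrArg conjTranspose hWp
      simpa [conjTranspose_mul, hps, -diagonal_conjTranspose] using this
    rw [conjTranspose_add, conjTranspose_mul, hfs, hps]
    have : (diagonal f * W + diagonal p) * (Wᴴ * diagonal f + diagonal p)
      = diagonal f * (W * Wᴴ) * diagonal f + diagonal f * (W * diagonal p)
        + (diagonal p * Wᴴ) * diagonal f + diagonal p * diagonal p := by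
      noncomm_ring
    rw [this, hWp, hpW, h]
    simp only [diagonal_mul_diagonal, Matrix.mul_zero, Matrix.zero_mul, add_zero, diagonal_add]
    rw [← diagonal_one]
    congr 1; ext i
    simp only [f, p]
    by_cases hi : l i = 0
    · simp [hi]
    · have : √(l i) ≠ 0 := by rw [Real.sqrt_ne_zero (hl i)]; exact hi
      simp only [hi, if_false, mul_zero, add_zero]
      norm_cast
      field_simp
      rw [Real.sq_sqrt (hl i)]
  · ext i j
    simp only [Matrix.add_apply, diagonal_mul, f, p, diagonal_apply]
    by_cases hi : l i = 0
    · simp [hrow i hi, hi]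
    · have : (√(l i) : ℂ) ≠ 0 := by
        rw [Complex.ofReal_ne_zero, Real.sqrt_ne_zero (hl i)]; exact hi
      have h0 : (if i = j then (if l i = 0 then (1 : ℂ) else 0) else 0) = 0 := by simp [hi]
      rw [h0, add_zero, Complex.ofReal_inv, ← mul_assoc, mul_inv_cancel₀ this, one_mul]

/-- Sorted singular value decomposition. -/
theorem svd_exists {n : ℕ} (W : Matrix (Fin n) (Fin n) ℂ) :
    ∃ (U V : Matrix (Fin n) (Fin n) ℂ) (d : Fin n → ℝ), U * Uᴴ = 1 ∧ V * Vᴴ = 1 ∧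
      (∀ i j, i ≤ j → d j ≤ d i) ∧ (∀ i, 0 ≤ d i) ∧
      U * W * Vᴴ = diagonal (fun i => (d i : ℂ)) := by
  have h1 : (W * Wᴴ).IsHermitian := isHermitian_mul_conjTranspose_self W
  have h2 : (Wᴴ * W).IsHermitian := isHermitian_conjTranspose_mul_self W
  have he : h1.eigenvalues = h2.eigenvalues :=
    (Matrix.IsHermitian.eigenvalues_eq_eigenvalues_iff h1 h2).2 (Matrix.charpoly_mul_comm W Wᴴ)
  have hl : ∀ i, 0 ≤ h1.eigenvalues i := fun i => eigenvalues_self_mul_conjTranspose_nonneg W i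
  have s1 := h1.conjStarAlgAut_star_eigenvectorUnitary
  have s2 := h2.conjStarAlgAut_star_eigenvectorUnitary
  rw [Unitary.conjStarAlgAut_star_apply] at s1 s2
  rw [← he] at s2
  have u1 : (h1.eigenvectorUnitary : Matrix (Fin n) (Fin n) ℂ) *
      star (h1.eigenvectorUnitary : Matrix (Fin n) (Fin n) ℂ) = 1 :=
    Unitary.coe_mul_star_self h1.eigenvectorUnitary
  have u2 : (h2.eigenvectorUnitary : Matrix (Fin n) (Fin n) ℂ) *
      star (h2.eigenvectorUnitary : Matrix (Fin n) (Fin n) ℂ) = 1 :=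
    Unitary.coe_mul_star_self h2.eigenvectorUnitary
  have v1 := Unitary.coe_star_mul_self h1.eigenvectorUnitary
  have v2 := Unitary.coe_star_mul_self h2.eigenvectorUnitary
  obtain ⟨U, hU⟩ : ∃ U, U = (h1.eigenvectorUnitary : Matrix (Fin n) (Fin n) ℂ) := ⟨_, rfl⟩
  obtain ⟨V, hV⟩ : ∃ U, U = (h2.eigenvectorUnitary : Matrix (Fin n) (Fin n) ℂ) := ⟨_, rfl⟩
  rw [← hU, Matrix.star_eq_conjTranspose] at s1 u1 v1
  rw [← hV, Matrix.star_eq_conjTranspose] at s2 u2 v2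
  obtain ⟨l, hle⟩ : ∃ l, l = h1.eigenvalues := ⟨_, rfl⟩
  rw [← hle] at s1 s2 hl
  obtain ⟨Q, hQ, hWQ⟩ := svd_aux (W := Uᴴ * W * V) hl (by
    rw [← show _ = diagonal (fun i => (l i : ℂ)) from s1]
    simp only [conjTranspose_mul, conjTranspose_conjTranspose]
    calc Uᴴ * W * V * (Vᴴ * (Wᴴ * U)) = Uᴴ * W * (V * Vᴴ) * Wᴴ * U := by simp only [Matrix.mul_assoc]
      _ = _ := by rw [u2]; simp only [Matrix.mul_assoc, Matrix.one_mul]) (by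
    rw [← show _ = diagonal (fun i => (l i : ℂ)) from s2]
    simp only [conjTranspose_mul, conjTranspose_conjTranspose]
    calc Vᴴ * (Wᴴ * U) * (Uᴴ * W * V) = Vᴴ * Wᴴ * (U * Uᴴ) * W * V := by simp only [Matrix.mul_assoc]
      _ = _ := by rw [u1]; simp only [Matrix.mul_assoc, Matrix.one_mul])
  -- the sorting permutation
  let τ := Tuple.sort (fun i => -√(l i))
  have hτ : Monotone ((fun i => -√(l i)) ∘ τ) := Tuple.monotone_sort _
  refine ⟨Uᴴ.submatrix τ id, (Q * Vᴴ).submatrix τ id, fun i => √(l (τ i)), ?_, ?_, ?_, ?_, ?_⟩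
  · rw [conjTranspose_submatrix, ← submatrix_mul _ _ _ id _ Function.bijective_id]
    simp [v1]
  · rw [conjTranspose_submatrix, ← submatrix_mul _ _ _ id _ Function.bijective_id]
    have : Q * Vᴴ * (Q * Vᴴ)ᴴ = 1 := by
      simp only [conjTranspose_mul, conjTranspose_conjTranspose]
      calc Q * Vᴴ * (V * Qᴴ) = Q * (Vᴴ * V) * Qᴴ := by simp only [Matrix.mul_assoc]
        _ = _ := by rw [v2, Matrix.mul_one, hQ]
    rw [this]; simp
  · intro i j hij
    have := hτ hij
    simpa using this
  · intro i; positivity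
  · have e : Uᴴ * W * (Q * Vᴴ)ᴴ = diagonal (fun i => ((√(l i) : ℝ) : ℂ)) := by
      simp only [conjTranspose_mul, conjTranspose_conjTranspose]
      rw [← Matrix.mul_assoc, hWQ, Matrix.mul_assoc, hQ, Matrix.mul_one]
    have : Uᴴ.submatrix τ id * W * ((Q * Vᴴ).submatrix τ id)ᴴ = (Uᴴ * W * (Q * Vᴴ)ᴴ).submatrix τ τ := by
      ext i j; simp [Matrix.mul_apply]
    rw [this, e]
    ext i j
    simp [diagonal_apply]

/-- index of the mode -/
def modeIdx {n : ℕ} (x : Fin (2 * n)) : Fin n := ⟨x.val / 2, by have := x.isLt; omega⟩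

/-- pair a mode and a quadrature -/
def quadEquiv (n : ℕ) : Fin n × Fin 2 ≃ Fin (2 * n) where
  toFun p := ⟨2 * p.1.val + p.2.val, by have := p.1.isLt; have := p.2.isLt; omega⟩
  invFun x := (modeIdx x, ⟨x.val % 2, by omega⟩)
  left_inv p := by
    obtain ⟨i, a⟩ := p
    ext
    · simp [modeIdx]; omega
    · simp; omega
  right_inv x := by
    ext; simp [modeIdx]; omega

theorem sum_quad {n : ℕ} (f : Fin (2 * n) → ℝ) :
    ∑ x, f x = ∑ k : Fin n, (f (quadEquiv n (k, 0)) + f (quadEquiv n (k, 1))) := by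
  rw [← (quadEquiv n).sum_comp, Fintype.sum_prod_type]
  simp [Fin.sum_univ_two]

theorem ext_quad {n : ℕ} {X Y : Matrix (Fin (2 * n)) (Fin (2 * n)) ℝ}
    (h : ∀ i j a b, X (quadEquiv n (i, a)) (quadEquiv n (j, b)) =
      Y (quadEquiv n (i, a)) (quadEquiv n (j, b))) : X = Y := by
  ext x y
  obtain ⟨⟨i, a⟩, rfl⟩ := (quadEquiv n).surjective x
  obtain ⟨⟨j, b⟩, rfl⟩ := (quadEquiv n).surjective y
  exact h i j a b

/-- realification of a complex matrix -/
noncomputable def phi {n : ℕ} (M : Matrix (Fin n) (Fin n) ℂ) :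
    Matrix (Fin (2 * n)) (Fin (2 * n)) ℝ :=
  (Matrix.of fun p q : Fin n × Fin 2 =>
    (!![(M p.1 q.1).re, -(M p.1 q.1).im; (M p.1 q.1).im, (M p.1 q.1).re] : Matrix (Fin 2) (Fin 2) ℝ)
      p.2 q.2).submatrix (quadEquiv n).symm (quadEquiv n).symm

theorem phi_apply {n : ℕ} (M : Matrix (Fin n) (Fin n) ℂ) (i j : Fin n) (a b : Fin 2) :
    phi M (quadEquiv n (i, a)) (quadEquiv n (j, b)) =
      (!![(M i j).re, -(M i j).im; (M i j).im, (M i j).re] : Matrix (Fin 2) (Fin 2) ℝ) a b := by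
  simp [phi]

theorem phi_mul {n : ℕ} (M N : Matrix (Fin n) (Fin n) ℂ) : phi (M * N) = phi M * phi N := by
  apply ext_quad
  intro i j a b
  rw [Matrix.mul_apply, sum_quad]
  simp only [phi_apply, Matrix.mul_apply, Complex.re_sum, Complex.im_sum, Complex.mul_re,
    Complex.mul_im]
  fin_cases a <;> fin_cases b <;> simp [← Finset.sum_neg_distrib, ← Finset.sum_sub_distrib] <;>
    (apply Finset.sum_congr rfl; intros; ring)

theorem phi_conjTranspose {n : ℕ} (M : Matrix (Fin n) (Fin n) ℂ) : phi Mᴴ = (phi M)ᵀ := by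
  apply ext_quad
  intro i j a b
  rw [Matrix.transpose_apply, phi_apply, phi_apply]
  fin_cases a <;> fin_cases b <;> simp

theorem phi_diag {n : ℕ} (d : Fin n → ℝ) :
    phi (diagonal fun i => (d i : ℂ)) = diagonal fun x => d (modeIdx x) := by
  apply ext_quad
  intro i j a b
  have hm : modeIdx (quadEquiv n (i, a)) = i := congrArg Prod.fst ((quadEquiv n).symm_apply_apply (i, a))
  rw [phi_apply, diagonal_apply, diagonal_apply, hm]
  simp only [EmbeddingLike.apply_eq_iff_eq, Prod.mk.injEq]
  by_cases hij : i = j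
  · subst hij
    fin_cases a <;> fin_cases b <;> simp
  · fin_cases a <;> fin_cases b <;> simp [hij]

theorem phi_one {n : ℕ} : phi (1 : Matrix (Fin n) (Fin n) ℂ) = 1 := by
  have := phi_diag (n := n) (fun _ => 1)
  simpa using this

theorem symp_apply {n : ℕ} (i j : Fin n) (a b : Fin 2) :
    symp n (quadEquiv n (i, a)) (quadEquiv n (j, b)) =
      if i = j then (!![0, -1; 1, 0] : Matrix (Fin 2) (Fin 2) ℝ) a b else 0 := by
  have h1 : (quadEquiv n (i, a)).val = 2 * i.val + a.val := rfl
  have h2 : (quadEquiv n (j, b)).val = 2 * j.val + b.val := rfl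
  simp only [symp, Matrix.of_apply, h1, h2, Fin.ext_iff]
  fin_cases a <;> fin_cases b <;> simp <;> split_ifs <;> first | rfl | omega

theorem symp_eq_phi (n : ℕ) : symp n = phi (diagonal fun _ => Complex.I) := by
  apply ext_quad
  intro i j a b
  rw [phi_apply, symp_apply, diagonal_apply]
  by_cases hij : i = j
  · fin_cases a <;> fin_cases b <;> simp [hij]
  · fin_cases a <;> fin_cases b <;> simp [hij]

theorem symp_sq (n : ℕ) : symp n * symp n = -1 := by
  rw [symp_eq_phi, ← phi_mul, diagonal_mul_diagonal]
  have := phi_diag (n := n) (fun _ => -1)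
  simp only [Complex.I_mul_I]
  simp only [Complex.ofReal_neg, Complex.ofReal_one] at this
  rw [this]
  ext i j; simp [diagonal_apply, Matrix.one_apply]; split_ifs <;> simp

theorem symp_transpose (n : ℕ) : (symp n)ᵀ = -symp n := by
  apply ext_quad
  intro i j a b
  rw [Matrix.transpose_apply, Matrix.neg_apply, symp_apply, symp_apply]
  by_cases hij : i = j
  · fin_cases a <;> fin_cases b <;> simp [hij]
  · simp [hij, Ne.symm hij]

theorem phi_comm {n : ℕ} (M : Matrix (Fin n) (Fin n) ℂ) : phi M * symp n = symp n * phi M := by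
  rw [symp_eq_phi, ← phi_mul, ← phi_mul]
  congr 1
  ext i j; simp [mul_comm]

theorem phi_surj {n : ℕ} {X : Matrix (Fin (2 * n)) (Fin (2 * n)) ℝ}
    (h : X * symp n = symp n * X) : ∃ M, phi M = X := by
  refine ⟨Matrix.of fun i j => ⟨X (quadEquiv n (i, 0)) (quadEquiv n (j, 0)),
    X (quadEquiv n (i, 1)) (quadEquiv n (j, 0))⟩, ?_⟩
  have key : ∀ i j a b, (X * symp n) (quadEquiv n (i, a)) (quadEquiv n (j, b)) =
    (symp n * X) (quadEquiv n (i, a)) (quadEquiv n (j, b)) := by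
    intros; rw [h]
  simp only [Matrix.mul_apply, sum_quad, symp_apply] at key
  apply ext_quad
  intro i j a b
  have k1 := key i j 0 0
  have k2 := key i j 1 0
  simp at k1 k2
  rw [phi_apply]
  fin_cases a <;> fin_cases b <;> simp [k1, k2]

/-- `Λ ⊕ ... ⊕ Λ` -/
noncomputable def Lam (n : ℕ) : Matrix (Fin (2 * n)) (Fin (2 * n)) ℝ :=
  diagonal fun i => if i.val % 2 = 0 then (1 : ℝ) else -1

theorem Lam_sq (n : ℕ) : Lam n * Lam n = 1 := by
  rw [Lam, diagonal_mul_diagonal, ← diagonal_one]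
  congr 1; ext i; split_ifs <;> simp

theorem Lam_transpose (n : ℕ) : (Lam n)ᵀ = Lam n := by simp [Lam]

theorem Lam_symp (n : ℕ) : Lam n * symp n = -(symp n * Lam n) := by
  apply ext_quad
  intro i j a b
  have h1 : (quadEquiv n (i, a)).val = 2 * i.val + a.val := rfl
  have h2 : (quadEquiv n (j, b)).val = 2 * j.val + b.val := rfl
  rw [Matrix.neg_apply, Lam, diagonal_mul, mul_diagonal, symp_apply, h1, h2]
  by_cases hij : i = j
  · fin_cases a <;> fin_cases b <;> simp [hij]
  · simp [hij]

theorem cmat_eq {n : ℕ} (r : Fin n → ℝ) :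
    cmat r = phi (diagonal fun i => ((Real.cosh (r i) : ℝ) : ℂ)) := by
  rw [phi_diag]; rfl

theorem smat_eq {n : ℕ} (r : Fin n → ℝ) :
    smat r = phi (diagonal fun i => ((Real.sinh (r i) : ℝ) : ℂ)) * Lam n := by
  rw [phi_diag, Lam, diagonal_mul_diagonal, smat]
  congr 1; ext i
  rw [mul_comm]; rfl

theorem cs_rel {n : ℕ} (r : Fin n → ℝ) : cmat r * cmat r = 1 + smat r * smat r := by
  rw [cmat, smat, diagonal_mul_diagonal, diagonal_mul_diagonal, ← diagonal_one, diagonal_add]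
  congr 1; ext i
  have := Real.cosh_sq (r ⟨i.val / 2, by have := i.isLt; omega⟩)
  split_ifs <;> nlinarith

theorem cmat_posDef {n : ℕ} (r : Fin n → ℝ) : (cmat r).PosDef :=
  Matrix.PosDef.diagonal fun _ => Real.cosh_pos _

theorem smat_transpose {n : ℕ} (r : Fin n → ℝ) : (smat r)ᵀ = smat r := by simp [smat]

theorem conj_eq_cmat {n : ℕ} {X O Y : Matrix (Fin (2 * n)) (Fin (2 * n)) ℝ} {r : Fin n → ℝ}
    (hX : X.PosDef) (hO : O * Oᵀ = 1) (hXX : X * X = 1 + Y) (hY : O * Y * Oᵀ = smat r * smat r) :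
    O * X * Oᵀ = cmat r := by
  have hO' : Oᵀ * O = 1 := mul_eq_one_comm.1 hO
  have hOu : IsUnit O := ⟨⟨_, _, hO, hO'⟩, rfl⟩
  apply sqrt_uniq _ (cmat_posDef r)
  · calc O * X * Oᵀ * (O * X * Oᵀ) = O * X * (Oᵀ * O) * X * Oᵀ := by simp only [Matrix.mul_assoc]
      _ = O * (X * X) * Oᵀ := by rw [hO', Matrix.mul_one]; simp only [Matrix.mul_assoc]
      _ = O * Oᵀ + O * Y * Oᵀ := by rw [hXX, Matrix.mul_add, Matrix.add_mul, Matrix.mul_one]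
      _ = _ := by rw [hO, hY, cs_rel]
  · have := (Matrix.IsUnit.posDef_star_right_conjugate_iff hOu (x := X)).2 hX
    rwa [Matrix.star_eq_conjTranspose, conjTranspose_eq_transpose_of_trivial] at this

theorem core {n : ℕ} {A B C : Matrix (Fin (2 * n)) (Fin (2 * n)) ℝ}
    (hA : A.PosDef) (hB : B.PosDef)
    (hAc : A * symp n = symp n * A) (hBc : B * symp n = symp n * B)
    (E1 : A * symp n * A + C * symp n * Cᵀ = symp n)
    (E2 : A * symp n * C + C * symp n * B = 0)
    (E3 : Cᵀ * symp n * C + B * symp n * B = symp n) :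
    ∃ (SA SB : Matrix (Fin (2 * n)) (Fin (2 * n)) ℝ) (r : Fin n → ℝ),
      SA * symp n * SAᵀ = symp n ∧
      SB * symp n * SBᵀ = symp n ∧
      (∀ i j : Fin n, i ≤ j → r j ≤ r i) ∧
      (∀ k, 0 ≤ r k) ∧ SA * A * SAᵀ = cmat r ∧ SA * C * SBᵀ = smat r ∧ SB * B * SBᵀ = cmat r := by
  have hJJ := symp_sq n
  have hLJ := Lam_symp n
  obtain ⟨J, hJ⟩ : ∃ J, J = symp n := ⟨_, rfl⟩
  rw [← hJ] at hAc hBc E1 E2 E3 hJJ hLJ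
  have hJu : IsUnit J := ⟨⟨J, -J, by simp [hJJ], by simp [hJJ]⟩, rfl⟩
  have hLL := Lam_sq n
  have hLt := Lam_transpose n
  have hD : C - J * C * J = 0 := by
    apply sylvester hA hB
    have e1 : A * (J * C * J) = C * B := by
      calc A * (J * C * J) = (A * J * C) * J := by simp only [Matrix.mul_assoc]
        _ = -(C * (J * B)) * J := by
          rw [eq_neg_of_add_eq_zero_left E2]; simp only [Matrix.mul_assoc]
        _ = -(C * B * (J * J)) := by rw [← hBc]; simp only [Matrix.mul_assoc, Matrix.neg_mul]
        _ = _ := by rw [hJJ]; simp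
    have e2 : J * C * J * B = A * C := by
      calc J * C * J * B = J * (C * J * B) := by simp only [Matrix.mul_assoc]
        _ = -(J * (A * J) * C) := by
          rw [eq_neg_of_add_eq_zero_right E2]; simp only [Matrix.mul_assoc, Matrix.mul_neg]
        _ = -((J * J) * A * C) := by rw [hAc]; simp only [Matrix.mul_assoc]
        _ = _ := by rw [hJJ]; simp
    rw [Matrix.mul_sub, Matrix.sub_mul, e1, e2]; abel
  have hCJ : C * J = -(J * C) := by
    conv_lhs => rw [sub_eq_zero.1 hD]
    rw [Matrix.mul_assoc, hJJ]; simp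
  have hW : (C * Lam n) * symp n = symp n * (C * Lam n) := by
    rw [← hJ, Matrix.mul_assoc, hLJ, Matrix.mul_neg, ← Matrix.mul_assoc, hCJ]
    simp [Matrix.mul_assoc]
  have hAA : A * A = 1 + C * Cᵀ := by
    apply hJu.mul_left_cancel
    have : J * (A * A) + -(J * (C * Cᵀ)) = J := by
      refine Eq.trans ?_ E1
      rw [hAc, hCJ]
      simp [Matrix.mul_assoc]
    rw [Matrix.mul_add, Matrix.mul_one]
    nth_rw 2 [← this]; abel
  have hBB : B * B = 1 + Cᵀ * C := by
    apply hJu.mul_right_cancel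
    have h' : J * C = -(C * J) := by rw [hCJ]; simp
    have : B * B * J + -(Cᵀ * C * J) = J := by
      refine Eq.trans ?_ E3
      rw [Matrix.mul_assoc B J B, ← hBc, Matrix.mul_assoc Cᵀ J C, h']
      simp [Matrix.mul_assoc]; abel
    rw [Matrix.add_mul, Matrix.one_mul]
    nth_rw 2 [← this]; abel
  obtain ⟨w, hw⟩ := phi_surj hW
  obtain ⟨u, v, d, hu, hv, hd, hd0, huv⟩ := svd_exists w
  have hU : phi u * (phi u)ᵀ = 1 := by rw [← phi_conjTranspose, ← phi_mul, hu, phi_one]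
  have hV : phi v * (phi v)ᵀ = 1 := by rw [← phi_conjTranspose, ← phi_mul, hv, phi_one]
  have hUc := phi_comm u
  have hVc := phi_comm v
  have hUWV : phi u * (C * Lam n) * (phi v)ᵀ = phi (diagonal fun i => (d i : ℂ)) := by
    rw [← huv, phi_mul, phi_mul, phi_conjTranspose, hw]
  obtain ⟨U, hUe⟩ : ∃ U, U = phi u := ⟨_, rfl⟩
  obtain ⟨V, hVe⟩ : ∃ V, V = phi v := ⟨_, rfl⟩
  obtain ⟨L, hLe⟩ : ∃ L, L = Lam n := ⟨_, rfl⟩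
  rw [← hUe, ← hVe, ← hLe] at hUWV
  rw [← hUe] at hU hUc
  rw [← hVe] at hV hVc
  rw [← hLe] at hLL hLt hLJ
  rw [← hJ] at hUc hVc
  let r : Fin n → ℝ := fun i => Real.arsinh (d i)
  obtain ⟨T, hT⟩ : ∃ T, T = L * V * L := ⟨_, rfl⟩
  have hTt : Tᵀ = L * Vᵀ * L := by rw [hT]; simp [Matrix.transpose_mul, hLt, Matrix.mul_assoc]
  have hTT : T * Tᵀ = 1 := by
    rw [hTt, hT]
    calc L * V * L * (L * Vᵀ * L) = L * V * (L * L) * Vᵀ * L := by simp only [Matrix.mul_assoc]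
      _ = L * (V * Vᵀ) * L := by rw [hLL, Matrix.mul_one]; simp only [Matrix.mul_assoc]
      _ = 1 := by rw [hV, Matrix.mul_one, hLL]
  have hF : U * C * Tᵀ = smat r := by
    rw [hTt, smat_eq, ← hLe]
    simp only [r, Real.sinh_arsinh]
    rw [← hUWV]; simp only [Matrix.mul_assoc]
  have hFt : T * Cᵀ * Uᵀ = smat r := by
    rw [← smat_transpose, ← hF]; simp [Matrix.transpose_mul, Matrix.mul_assoc]
  have hU' : Uᵀ * U = 1 := mul_eq_one_comm.1 hU
  have hT' : Tᵀ * T = 1 := mul_eq_one_comm.1 hTT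
  refine ⟨U, T, r, ?_, ?_, ?_, ?_, ?_, hF, ?_⟩
  · rw [← hJ, hUc, Matrix.mul_assoc, hU, Matrix.mul_one]
  · have hTc : T * J = J * T := by
      rw [hT]
      calc L * V * L * J = L * V * (L * J) := by simp only [Matrix.mul_assoc]
        _ = -(L * (V * J) * L) := by rw [hLJ]; simp [Matrix.mul_assoc]
        _ = -((L * J) * V * L) := by rw [hVc]; simp [Matrix.mul_assoc]
        _ = _ := by rw [hLJ]; simp [Matrix.mul_assoc]
    rw [← hJ, hTc, Matrix.mul_assoc, hTT, Matrix.mul_one]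
  · intro i j hij
    exact Real.arsinh_le_arsinh.2 (hd i j hij)
  · intro k
    exact Real.arsinh_nonneg_iff.2 (hd0 k)
  · apply conj_eq_cmat hA hU hAA
    calc U * (C * Cᵀ) * Uᵀ = U * C * (Tᵀ * T) * Cᵀ * Uᵀ := by
          rw [hT', Matrix.mul_one]; simp only [Matrix.mul_assoc]
      _ = (U * C * Tᵀ) * (T * Cᵀ * Uᵀ) := by simp only [Matrix.mul_assoc]
      _ = _ := by rw [hF, hFt]
  · apply conj_eq_cmat hB hTT hBB
    calc T * (Cᵀ * C) * Tᵀ = T * Cᵀ * (Uᵀ * U) * C * Tᵀ := by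
          rw [hU', Matrix.mul_one]; simp only [Matrix.mul_assoc]
      _ = (T * Cᵀ * Uᵀ) * (U * C * Tᵀ) := by simp only [Matrix.mul_assoc]
      _ = _ := by rw [hF, hFt]

theorem gamma_posDef {m : Type*} [Fintype m] [DecidableEq m] {γ J : Matrix m m ℝ}
    (hsym : γ.IsSymm) (hJt : Jᵀ = -J)
    (hpsd : Matrix.PosSemidef (γ.map Complex.ofReal + Complex.I • J.map Complex.ofReal))
    (hpure : (γ * J) * (γ * J) = -1) : γ.PosDef := by
  have hu : IsUnit γ := by
    have h1 : γ * (-(J * (γ * J))) = 1 := by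
      rw [Matrix.mul_neg, ← Matrix.mul_assoc, hpure]; simp
    exact ⟨⟨γ, _, h1, mul_eq_one_comm.1 h1⟩, rfl⟩
  have hg : γ.PosSemidef := by
    apply PosSemidef.of_dotProduct_mulVec_nonneg
    · simpa [Matrix.IsHermitian] using hsym.eq
    · intro x
      have h := hpsd.re_dotProduct_nonneg (fun i => (x i : ℂ))
      have e : RCLike.re (star (fun i => (x i : ℂ)) ⬝ᵥ
          ((γ.map Complex.ofReal + Complex.I • J.map Complex.ofReal) *ᵥ (fun i => (x i : ℂ)))) =
          star x ⬝ᵥ (γ *ᵥ x) := by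
        simp [dotProduct, mulVec, Matrix.add_apply]
      rwa [e] at h
  exact hg.posDef_iff_isUnit.2 hu
/-- **Standard form of pure `n×n` Gaussian states.** Any covariance matrix `γ` of a pure
Gaussian state of `n×n` modes (i.e. `γ` real symmetric, `γ + i·σ_{2n} ≥ 0`, and
`(γσ_{2n})² = -1`) can be brought by local symplectic transformations `S_A ⊕ S_B` into
the covariance matrix of a product of `n` two-mode squeezed states with ordered
squeezing parameters `r₁ ≥ … ≥ r_n ≥ 0`. -/
theorem pure_gaussian_standard_form (n : ℕ) (hn : 1 ≤ n)
    (γ : Matrix (Fin (2 * n) ⊕ Fin (2 * n)) (Fin (2 * n) ⊕ Fin (2 * n)) ℝ)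
    (hsym : γ.IsSymm)
    (hpsd : Matrix.PosSemidef
      (γ.map Complex.ofReal + Complex.I • (sympBig n).map Complex.ofReal))
    (hpure : (γ * sympBig n) * (γ * sympBig n) = -1) :
    ∃ (SA SB : Matrix (Fin (2 * n)) (Fin (2 * n)) ℝ) (r : Fin n → ℝ),
      SA * symp n * SAᵀ = symp n ∧
      SB * symp n * SBᵀ = symp n ∧
      (∀ i j : Fin n, i ≤ j → r j ≤ r i) ∧
      (∀ k, 0 ≤ r k) ∧
      (Matrix.fromBlocks SA 0 0 SB) * γ * (Matrix.fromBlocks SA 0 0 SB)ᵀ =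
        Matrix.fromBlocks (cmat r) (smat r) (smat r) (cmat r) := by
  have hJJ := symp_sq n
  have hJt := symp_transpose n
  have hγ : γ.PosDef := gamma_posDef hsym (by
    simp [sympBig, fromBlocks_transpose, hJt, fromBlocks_neg]) hpsd hpure
  obtain ⟨A, hAe⟩ : ∃ A, A = γ.toBlocks₁₁ := ⟨_, rfl⟩
  obtain ⟨C, hCe⟩ : ∃ C, C = γ.toBlocks₁₂ := ⟨_, rfl⟩
  obtain ⟨B, hBe⟩ : ∃ B, B = γ.toBlocks₂₂ := ⟨_, rfl⟩
  have hA : A.PosDef := hAe ▸ hγ.submatrix Sum.inl_injective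
  have hB : B.PosDef := hBe ▸ hγ.submatrix Sum.inr_injective
  have hCt : γ.toBlocks₂₁ = Cᵀ := by
    ext i j
    rw [hCe]
    exact hsym.apply _ _
  have hγe : γ = fromBlocks A C Cᵀ B := by
    rw [← hCt, hAe, hBe, hCe, fromBlocks_toBlocks]
  rw [hγe, sympBig, fromBlocks_multiply, fromBlocks_multiply, ← fromBlocks_one, fromBlocks_neg,
    fromBlocks_inj] at hpure
  simp only [Matrix.mul_zero, add_zero, zero_add, neg_zero] at hpure
  obtain ⟨F1, F2, -, F3⟩ := hpure
  obtain ⟨J, hJ⟩ : ∃ J, J = symp n := ⟨_, rfl⟩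
  obtain ⟨S, hSp, hSJ, hSc⟩ := partial_williamson hA hJt hJJ
  obtain ⟨T, hTp, hTJ, hTc⟩ := partial_williamson hB hJt hJJ
  have hSt : Sᵀ = S := by simpa [Matrix.IsHermitian] using hSp.1
  have hTt : Tᵀ = T := by simpa [Matrix.IsHermitian] using hTp.1
  rw [← hJ] at F1 F2 F3 hSJ hTJ hSc hTc hJJ
  have hJu : IsUnit J := ⟨⟨J, -J, by simp [hJJ], by simp [hJJ]⟩, rfl⟩
  have E1 : A * J * A + C * J * Cᵀ = J := by
    apply hJu.mul_right_cancel
    rw [hJJ, ← F1]; simp [Matrix.add_mul, Matrix.mul_assoc]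
  have E2 : A * J * C + C * J * B = 0 := by
    apply hJu.mul_right_cancel
    rw [Matrix.zero_mul, ← F2]; simp [Matrix.add_mul, Matrix.mul_assoc]
  have E3 : Cᵀ * J * C + B * J * B = J := by
    apply hJu.mul_right_cancel
    rw [hJJ, ← F3]; simp [Matrix.add_mul, Matrix.mul_assoc]
  have hCt' : (S * C * T)ᵀ = T * Cᵀ * S := by
    simp [Matrix.transpose_mul, hSt, hTt, Matrix.mul_assoc]
  have hA' : (S * A * S).PosDef := by
    have := (Matrix.IsUnit.posDef_star_right_conjugate_iff hSp.isUnit (x := A)).2 hA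
    rwa [Matrix.star_eq_conjTranspose, conjTranspose_eq_transpose_of_trivial, hSt] at this
  have hB' : (T * B * T).PosDef := by
    have := (Matrix.IsUnit.posDef_star_right_conjugate_iff hTp.isUnit (x := B)).2 hB
    rwa [Matrix.star_eq_conjTranspose, conjTranspose_eq_transpose_of_trivial, hTt] at this
  obtain ⟨U, V, r, hU, hV, hr, hr0, h1, h2, h3⟩ := core (C := S * C * T) hA' hB'
    (by rw [← hJ]; exact hSc) (by rw [← hJ]; exact hTc)
    (by
      rw [← hJ, hCt']
      calc S * A * S * J * (S * A * S) + S * C * T * J * (T * Cᵀ * S)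
          = S * A * (S * J * S) * A * S + S * C * (T * J * T) * Cᵀ * S := by
            simp only [Matrix.mul_assoc]
        _ = S * (A * J * A + C * J * Cᵀ) * S := by
            rw [hSJ, hTJ]; simp only [Matrix.mul_assoc, Matrix.mul_add, Matrix.add_mul]
        _ = J := by rw [E1, hSJ])
    (by
      rw [← hJ]
      calc S * A * S * J * (S * C * T) + S * C * T * J * (T * B * T)
          = S * A * (S * J * S) * C * T + S * C * (T * J * T) * B * T := by
            simp only [Matrix.mul_assoc]
        _ = S * (A * J * C + C * J * B) * T := by
            rw [hSJ, hTJ]; simp only [Matrix.mul_assoc, Matrix.mul_add, Matrix.add_mul]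
        _ = 0 := by rw [E2]; simp)
    (by
      rw [← hJ, hCt']
      calc T * Cᵀ * S * J * (S * C * T) + T * B * T * J * (T * B * T)
          = T * Cᵀ * (S * J * S) * C * T + T * B * (T * J * T) * B * T := by
            simp only [Matrix.mul_assoc]
        _ = T * (Cᵀ * J * C + B * J * B) * T := by
            rw [hSJ, hTJ]; simp only [Matrix.mul_assoc, Matrix.mul_add, Matrix.add_mul]
        _ = J := by rw [E3, hTJ])
  refine ⟨U * S, V * T, r, ?_, ?_, hr, hr0, ?_⟩
  · rw [Matrix.transpose_mul, hSt, ← hJ]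
    rw [← hJ] at hU
    calc U * S * J * (S * Uᵀ) = U * (S * J * S) * Uᵀ := by simp only [Matrix.mul_assoc]
      _ = J := by rw [hSJ, hU]
  · rw [Matrix.transpose_mul, hTt, ← hJ]
    rw [← hJ] at hV
    calc V * T * J * (T * Vᵀ) = V * (T * J * T) * Vᵀ := by simp only [Matrix.mul_assoc]
      _ = J := by rw [hTJ, hV]
  · rw [hγe, fromBlocks_transpose, fromBlocks_multiply, fromBlocks_multiply, fromBlocks_inj]
    simp only [Matrix.mul_zero, Matrix.zero_mul, add_zero, zero_add, Matrix.transpose_mul, hSt, hTt,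
      Matrix.transpose_zero]
    refine ⟨?_, ?_, ?_, ?_⟩
    · rw [← h1]; simp only [Matrix.mul_assoc]
    · rw [← h2]; simp only [Matrix.mul_assoc]
    · rw [← smat_transpose, ← h2]
      simp only [Matrix.transpose_mul, Matrix.transpose_transpose, hSt, hTt, Matrix.mul_assoc]
    · rw [← h3]; simp only [Matrix.mul_assoc]
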